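/- Let H = (V, E) be a 3-edge-connected finite graph and let X ⊆ V be minimal (with respect to inclusion) subject to the conditions that d(X) = 3 and the subgraph induced by X contains at least two cycles. If e ∈ E has both ends in X, then every 3-edge-cut of H containing e has the form δ(Y) where Y ⊆ X and the subgraph induced by Y contains at most one cycle. -/

import Mathlib

open Finset

/-- The set of edges with exactly one endpoint in `S` (the edge cut `δ(S)`). -/
def cutset {V E : Type} [Fintype E] [DecidableEq V] (src tgt : E → V) (S : Finset V) :
    Finset E :=
  Finset.univ.filter fun e => (src e ∈ S ∧ tgt e ∉ S) ∨ (tgt e ∈ S ∧ src e ∉ S)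

/-- A multigraph (given by endpoint maps `src`, `tgt` on an edge type) is `t`-edge-connected:
every edge cut determined by a nonempty proper vertex set has at least `t` edges.
(For `t ≥ 1` this is equivalent to being connected with all edge cuts of size at least `t`.) -/
def EdgeConnected {V E : Type} [Fintype V] [Fintype E] [DecidableEq V]
    (src tgt : E → V) (t : ℕ) : Prop :=
  ∀ S : Finset V, S.Nonempty → S ≠ Finset.univ → t ≤ (cutset src tgt S).card

/-- The boundary `∂φ(v) = Σ_{e out of v} φ(e) − Σ_{e into v} φ(e)`. -/
def bdry {V E A : Type} [Fintype E] [DecidableEq V] [AddCommGroup A]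
    (src tgt : E → V) (φ : E → A) (v : V) : A :=
  (∑ e : E, if src e = v then φ e else 0) - (∑ e : E, if tgt e = v then φ e else 0)

/-- The degree of `v` with respect to the edge set `F` (a loop at `v` counts twice). -/
def degr {V E : Type} [DecidableEq V] (src tgt : E → V) (F : Finset E) (v : V) : ℕ :=
  (F.filter fun e => src e = v).card + (F.filter fun e => tgt e = v).card

/-- Edge `e` joins the vertices `u` and `v` (in one of the two directions). -/
def linked {V E : Type} (src tgt : E → V) (e : E) (u v : V) : Prop :=
  (src e = u ∧ tgt e = v) ∨ (src e = v ∧ tgt e = u)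

/-- `(n, vs, es)` is a cycle all of whose vertices lie in `S`: a closed walk
`vs 0, es 0, vs 1, …, es (n-1), vs n = vs 0` of positive length with pairwise
distinct vertices `vs 0, …, vs (n-1)` and pairwise distinct edges. -/
def IsCycleIn {V E : Type} (src tgt : E → V) (S : Finset V)
    (n : ℕ) (vs : Fin (n + 1) → V) (es : Fin n → E) : Prop :=
  0 < n ∧ vs (Fin.last n) = vs 0 ∧
  (∀ i j : Fin n, vs i.castSucc = vs j.castSucc → i = j) ∧
  Function.Injective es ∧
  (∀ i : Fin n, linked src tgt (es i) (vs i.castSucc) (vs i.succ)) ∧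
  (∀ i : Fin (n + 1), vs i ∈ S)

/-- The subgraph induced by `S` contains a cycle. -/
def HasCycleIn {V E : Type} (src tgt : E → V) (S : Finset V) : Prop :=
  ∃ (n : ℕ) (vs : Fin (n + 1) → V) (es : Fin n → E), IsCycleIn src tgt S n vs es

/-- The subgraph induced by `S` contains at least two (distinct) cycles,
i.e. two cycles with different edge sets. -/
def TwoCyclesIn {V E : Type} [DecidableEq E] (src tgt : E → V) (S : Finset V) : Prop :=
  ∃ (n : ℕ) (vs : Fin (n + 1) → V) (es : Fin n → E)
    (n' : ℕ) (vs' : Fin (n' + 1) → V) (es' : Fin n' → E),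
    IsCycleIn src tgt S n vs es ∧ IsCycleIn src tgt S n' vs' es' ∧
    Finset.univ.image es ≠ Finset.univ.image es'

/-- The subgraph induced by `S` contains at most one cycle:
any two cycles in it have the same edge set. -/
def AtMostOneCycleIn {V E : Type} [DecidableEq E] (src tgt : E → V) (S : Finset V) : Prop :=
  ∀ (n : ℕ) (vs : Fin (n + 1) → V) (es : Fin n → E)
    (n' : ℕ) (vs' : Fin (n' + 1) → V) (es' : Fin n' → E),
    IsCycleIn src tgt S n vs es → IsCycleIn src tgt S n' vs' es' →
    Finset.univ.image es = Finset.univ.image es'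

theorem cutset_compl {V E : Type} [Fintype V] [Fintype E] [DecidableEq V]
    (src tgt : E → V) (S : Finset V) : cutset src tgt Sᶜ = cutset src tgt S := by
  ext e
  simp only [cutset, mem_filter, mem_univ, true_and, mem_compl]
  tauto

/-- The number of edges with one endpoint in `S` and the other in `T`, for disjoint `S`, `T`. -/
def edgesBetween {V E : Type} [Fintype E] [DecidableEq V] (src tgt : E → V) (S T : Finset V) :
    ℕ :=
  (Finset.univ.filter fun e => (src e ∈ S ∧ tgt e ∈ T) ∨ (tgt e ∈ S ∧ src e ∈ T)).card

theorem edgesBetween_comm {V E : Type} [Fintype E] [DecidableEq V] (src tgt : E → V)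
    (S T : Finset V) : edgesBetween src tgt S T = edgesBetween src tgt T S := by
  unfold edgesBetween
  congr 1
  ext e
  simp only [mem_filter, mem_univ, true_and]
  tauto

theorem card_cutset {V E : Type} [Fintype V] [Fintype E] [DecidableEq V] (src tgt : E → V)
    (S : Finset V) : (cutset src tgt S).card = edgesBetween src tgt S Sᶜ := by
  simp only [cutset, edgesBetween, mem_compl]

theorem edgesBetween_union_right {V E : Type} [Fintype E] [DecidableEq V] (src tgt : E → V)
    {S T U : Finset V} (hST : Disjoint S T) (hTU : Disjoint T U) :
    edgesBetween src tgt S (T ∪ U) = edgesBetween src tgt S T + edgesBetween src tgt S U := by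
  classical
  unfold edgesBetween
  rw [← card_union_of_disjoint]
  · congr 1
    ext e
    simp only [mem_filter, mem_univ, true_and, mem_union]
    tauto
  · rw [Finset.disjoint_left] at *
    intro e
    simp only [mem_filter, mem_univ, true_and]
    grind

theorem edgesBetween_union_left {V E : Type} [Fintype E] [DecidableEq V] (src tgt : E → V)
    {S T U : Finset V} (hST : Disjoint S T) (hSU : Disjoint S U) :
    edgesBetween src tgt (S ∪ T) U = edgesBetween src tgt S U + edgesBetween src tgt T U := by
  rw [edgesBetween_comm, edgesBetween_union_right src tgt hSU.symm hST,
    edgesBetween_comm src tgt U S, edgesBetween_comm src tgt U T]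

/-- Two 3-edge-cuts of a 3-edge-connected graph do not cross. -/
theorem EdgeConnected.not_crossing {V E : Type} [Fintype V] [Fintype E] [DecidableEq V]
    {src tgt : E → V} (h : EdgeConnected src tgt 3) {X Y : Finset V}
    (hX : (cutset src tgt X).card = 3) (hY : (cutset src tgt Y).card = 3)
    (hA : (X ∩ Y).Nonempty) (hB : (X ∩ Yᶜ).Nonempty) :
    ¬ ((Xᶜ ∩ Y).Nonempty ∧ (Xᶜ ∩ Yᶜ).Nonempty) := by
  rintro ⟨hC, hD⟩
  obtain ⟨A, B, C, D, hAdef, hBdef, hCdef, hDdef⟩ : ∃ A B C D : Finset V,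
      X ∩ Y = A ∧ X ∩ Yᶜ = B ∧ Xᶜ ∩ Y = C ∧ Xᶜ ∩ Yᶜ = D := ⟨_, _, _, _, rfl, rfl, rfl, rfl⟩
  have hAB : Disjoint A B := by rw [Finset.disjoint_left]; grind [mem_compl]
  have hAC : Disjoint A C := by rw [Finset.disjoint_left]; grind [mem_compl]
  have hAD : Disjoint A D := by rw [Finset.disjoint_left]; grind [mem_compl]
  have hBC : Disjoint B C := by rw [Finset.disjoint_left]; grind [mem_compl]
  have hBD : Disjoint B D := by rw [Finset.disjoint_left]; grind [mem_compl]
  have hCD : Disjoint C D := by rw [Finset.disjoint_left]; grind [mem_compl]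
  have complA : Aᶜ = B ∪ (C ∪ D) := by ext; grind [mem_compl]
  have complB : Bᶜ = A ∪ (C ∪ D) := by ext; grind [mem_compl]
  have complC : Cᶜ = A ∪ (B ∪ D) := by ext; grind [mem_compl]
  have complD : Dᶜ = A ∪ (B ∪ C) := by ext; grind [mem_compl]
  have eqX : X = A ∪ B := by ext; grind [mem_compl]
  have complX : (A ∪ B)ᶜ = C ∪ D := by ext; grind [mem_compl]
  have eqY : Y = A ∪ C := by ext; grind [mem_compl]
  have complY : (A ∪ C)ᶜ = B ∪ D := by ext; grind [mem_compl]
  rw [hAdef] at hA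
  rw [hBdef] at hB
  rw [hCdef] at hC
  rw [hDdef] at hD
  have dA := h A hA fun hA' => hB.ne_empty (by simpa [hA', ← top_eq_univ] using hAB)
  have dB := h B hB fun hB' => hA.ne_empty (by simpa [hB', ← top_eq_univ] using hAB)
  have dC := h C hC fun hC' => hA.ne_empty (by simpa [hC', ← top_eq_univ] using hAC)
  have dD := h D hD fun hD' => hA.ne_empty (by simpa [hD', ← top_eq_univ] using hAD)
  rw [card_cutset, complA, edgesBetween_union_right, edgesBetween_union_right] at dA
  rw [card_cutset, complB, edgesBetween_union_right, edgesBetween_union_right,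
    edgesBetween_comm src tgt B A] at dB
  rw [card_cutset, complC, edgesBetween_union_right, edgesBetween_union_right,
    edgesBetween_comm src tgt C A, edgesBetween_comm src tgt C B] at dC
  rw [card_cutset, complD, edgesBetween_union_right, edgesBetween_union_right,
    edgesBetween_comm src tgt D A, edgesBetween_comm src tgt D B,
    edgesBetween_comm src tgt D C] at dD
  rw [eqX, card_cutset, complX, edgesBetween_union_left, edgesBetween_union_right,
    edgesBetween_union_right] at hX
  rw [eqY, card_cutset, complY, edgesBetween_union_left, edgesBetween_union_right,
    edgesBetween_union_right, edgesBetween_comm src tgt C B] at hY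
  · omega
  all_goals simp only [disjoint_union_right, disjoint_comm, *, and_self]

/-- Let `H` be a 3-edge-connected finite graph and let `X ⊆ V` be minimal (w.r.t.
inclusion) subject to: `d(X) = 3` and `X` induces a graph containing at least two cycles.
If `e` has both ends in `X`, then every 3-edge-cut of `H` containing `e` has the form
`δ(Y)` where `Y ⊆ X` induces a graph containing at most one cycle. -/
theorem three_cut_pushing
    (V E : Type) [Fintype V] [Fintype E] [DecidableEq V] [DecidableEq E]
    (src tgt : E → V)
    (h3ec : EdgeConnected src tgt 3)
    (X : Finset V)
    (hXcut : (cutset src tgt X).card = 3)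
    (hXcyc : TwoCyclesIn src tgt X)
    (hmin : ∀ X' : Finset V, X' ⊆ X →
      (cutset src tgt X').card = 3 → TwoCyclesIn src tgt X' → X' = X)
    (e : E) (hesrc : src e ∈ X) (hetgt : tgt e ∈ X)
    (Y : Finset V) (hY1 : Y.Nonempty) (hY2 : Y ≠ Finset.univ)
    (hYcut : (cutset src tgt Y).card = 3) (heY : e ∈ cutset src tgt Y) :
    ∃ Y' : Finset V, cutset src tgt Y' = cutset src tgt Y ∧ Y' ⊆ X ∧
      AtMostOneCycleIn src tgt Y' := by
  have hA : (X ∩ Y).Nonempty := by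
    simp only [cutset, mem_filter, mem_univ, true_and] at heY
    rcases heY with h | h
    · exact ⟨_, mem_inter.2 ⟨hesrc, h.1⟩⟩
    · exact ⟨_, mem_inter.2 ⟨hetgt, h.1⟩⟩
  have hB : (X ∩ Yᶜ).Nonempty := by
    simp only [cutset, mem_filter, mem_univ, true_and] at heY
    rcases heY with h | h
    · exact ⟨_, mem_inter.2 ⟨hetgt, mem_compl.2 h.2⟩⟩
    · exact ⟨_, mem_inter.2 ⟨hesrc, mem_compl.2 h.2⟩⟩
  have atMostOne : ∀ Z : Finset V, Z ⊆ X → (X ∩ Zᶜ).Nonempty →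
      (cutset src tgt Z).card = 3 → AtMostOneCycleIn src tgt Z := by
    intro Z hZX hne hcut n vs es n' vs' es' hc hc'
    by_contra hdiff
    have hZ := hmin Z hZX hcut ⟨n, vs, es, n', vs', es', hc, hc', hdiff⟩
    simp [hZ] at hne
  by_cases hC : (Xᶜ ∩ Y).Nonempty
  · have hD : ¬ (Xᶜ ∩ Yᶜ).Nonempty := fun hD => h3ec.not_crossing hXcut hYcut hA hB ⟨hC, hD⟩
    have hsub : Yᶜ ⊆ X := fun v hv => by
      by_contra hvX
      exact hD ⟨v, mem_inter.2 ⟨mem_compl.2 hvX, hv⟩⟩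
    exact ⟨Yᶜ, cutset_compl src tgt Y, hsub,
      atMostOne _ hsub (by rwa [compl_compl]) (by rwa [cutset_compl])⟩
  · have hsub : Y ⊆ X := fun v hv => by
      by_contra hvX
      exact hC ⟨v, mem_inter.2 ⟨mem_compl.2 hvX, hv⟩⟩
    exact ⟨Y, rfl, hsub, atMostOne _ hsub hB hYcut⟩
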